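/- Compactness in (𝒜, 𝓡_{α,β}): let (μʲ) ⊂ 𝒜 with sup_j 𝓡_{α,β}(μʲ) < ∞. Then, up to a subsequence, there exists μ ∈ 𝒜 such that μʲ_t ⇀* μ_t (weak-* in ℳ(Ω)) for a.e. t ∈ I and 𝓡_{α,β}(μ) ≤ liminf_j 𝓡_{α,β}(μʲ). -/

import Mathlib

open MeasureTheory Filter Topology Set
open scoped ENNReal NNReal RealInnerProductSpace

noncomputable section

/-- The unit time interval `[0,1] ⊆ ℝ`. -/
def unitI : Set ℝ := Set.Icc 0 1

/-- Lebesgue measure restricted to the unit interval. -/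
def lebI : Measure ℝ := volume.restrict unitI

/-- The (pointwise) variation of a curve `f : ℝ → X` on a set `s ⊆ ℝ`,
with respect to a distance function `d`. -/
def varOn {X : Type*} (d : X → X → ℝ≥0∞) (f : ℝ → X) (s : Set ℝ) : ℝ≥0∞ :=
  ⨆ p : ℕ × { u : ℕ → ℝ // Monotone u ∧ ∀ i, u i ∈ s },
    ∑ i ∈ Finset.range p.1, d (f (p.2.1 (i + 1))) (f (p.2.1 i))

/-- The essential variation of `f` on `s`: infimum of variations over a.e. representatives. -/
def essVarOn {X : Type*} (d : X → X → ℝ≥0∞) (f : ℝ → X) (s : Set ℝ) : ℝ≥0∞ :=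
  ⨅ g ∈ {g : ℝ → X | ∀ᵐ t ∂(volume.restrict s), g t = f t}, varOn d g s

/-- Essential variation on the unit interval. -/
def essVar {X : Type*} (d : X → X → ℝ≥0∞) (f : ℝ → X) : ℝ≥0∞ := essVarOn d f unitI

/-- Couplings (transport plans) between two measures. -/
def IsCoupling {X : Type*} [MeasurableSpace X] (ρp ρm : Measure X)
    (π : Measure (X × X)) : Prop :=
  π.map Prod.fst = ρp ∧ π.map Prod.snd = ρm

/-- The Wasserstein-1 distance between measures. -/
def W1 {X : Type*} [MeasurableSpace X] [PseudoEMetricSpace X]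
    (ρp ρm : Measure X) : ℝ≥0∞ :=
  ⨅ π ∈ {π : Measure (X × X) | IsCoupling ρp ρm π}, ∫⁻ q, edist q.1 q.2 ∂π

/-- `W1` as a distance function on measures. -/
def W1M {X : Type*} [MeasurableSpace X] [PseudoEMetricSpace X] :
    Measure X → Measure X → ℝ≥0∞ := fun a b => W1 a b

/-- Wasserstein-1 distance on probability measures. -/
def W1P {X : Type*} [MeasurableSpace X] [PseudoEMetricSpace X] :
    ProbabilityMeasure X → ProbabilityMeasure X → ℝ≥0∞ :=
  fun a b => W1 (a : Measure X) (b : Measure X)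

/-- The admissible set `𝒜 = ℝ₊ ⬝ BV(I; 𝒲₁(Ω))` of weighted BV curves of probability measures. -/
def Adm {n : ℕ} (Ω : Set (EuclideanSpace ℝ (Fin n))) : Set (ℝ → Measure ↥Ω) :=
  {μ | ∃ (c : ℝ≥0) (ρ : ℝ → ProbabilityMeasure ↥Ω),
      essVar W1P ρ < ⊤ ∧ ∀ t, μ t = (c : ℝ≥0∞) • (ρ t : Measure ↥Ω)}

/-- The weight `ω(μ)` of an admissible curve. -/
def wt {n : ℕ} {Ω : Set (EuclideanSpace ℝ (Fin n))} (μ : ℝ → Measure ↥Ω) : ℝ :=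
  (μ 0 Set.univ).toReal

/-- The regularizer `𝓡_{α,β}(μ) = α ω(μ) + β essvar(μ)`. -/
def Reg {n : ℕ} {Ω : Set (EuclideanSpace ℝ (Fin n))} (α β : ℝ)
    (μ : ℝ → Measure ↥Ω) : ℝ :=
  α * wt μ + β * (essVar W1M μ).toReal

/-- Weak-* convergence of a sequence of measures (tested against continuous functions). -/
def WStarTendsto {X : Type*} [MeasurableSpace X] [TopologicalSpace X]
    (μs : ℕ → Measure X) (μ : Measure X) : Prop :=
  ∀ φ : C(X, ℝ), Tendsto (fun j => ∫ x, φ x ∂(μs j)) atTop (𝓝 (∫ x, φ x ∂μ))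

/-- A.e. (in time) weak-* convergence of curves of measures. -/
def AEWStar {n : ℕ} {Ω : Set (EuclideanSpace ℝ (Fin n))}
    (μs : ℕ → (ℝ → Measure ↥Ω)) (μ : ℝ → Measure ↥Ω) : Prop :=
  ∀ᵐ t ∂lebI, WStarTendsto (fun j => μs j t) (μ t)

/-- Weak convergence in a real inner product space. -/
def WeakTendsto {Y : Type*} [NormedAddCommGroup Y] [InnerProductSpace ℝ Y]
    (ys : ℕ → Y) (y : Y) : Prop :=
  ∀ z : Y, Tendsto (fun j => @inner ℝ Y _ (ys j) z) atTop (𝓝 (@inner ℝ Y _ y z))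


section Transport

variable {X : Type*} [MeasurableSpace X]

lemma IsCoupling.measure_univ_left {a b : Measure X} {π : Measure (X × X)}
    (h : IsCoupling a b π) : π univ = a univ := by
  rw [← h.1, Measure.map_apply measurable_fst MeasurableSet.univ, preimage_univ]

lemma IsCoupling.measure_univ_right {a b : Measure X} {π : Measure (X × X)}
    (h : IsCoupling a b π) : π univ = b univ := by
  rw [← h.2, Measure.map_apply measurable_snd MeasurableSet.univ, preimage_univ]

lemma IsCoupling.smul {a b : Measure X} {π : Measure (X × X)} (h : IsCoupling a b π)
    (c : ℝ≥0∞) : IsCoupling (c • a) (c • b) (c • π) := by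
  constructor
  · rw [Measure.map_smul, h.1]
  · rw [Measure.map_smul, h.2]

lemma W1_le_of_isCoupling [PseudoEMetricSpace X] {a b : Measure X} {π : Measure (X × X)}
    (h : IsCoupling a b π) : W1 a b ≤ ∫⁻ q, edist q.1 q.2 ∂π :=
  iInf₂_le π h

lemma measure_univ_eq_of_W1_ne_top [PseudoEMetricSpace X] {a b : Measure X}
    (h : W1 a b ≠ ⊤) : a univ = b univ := by
  by_contra hne
  refine h (iInf₂_eq_top.2 fun π hπ => absurd ?_ hne)
  rw [← IsCoupling.measure_univ_left hπ, IsCoupling.measure_univ_right hπ]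

lemma W1_smul_le [PseudoEMetricSpace X] (a b : Measure X) {c : ℝ≥0∞} (hc : c ≠ ⊤) :
    W1 (c • a) (c • b) ≤ c * W1 a b := by
  rcases eq_or_ne c 0 with rfl | h0
  · refine (W1_le_of_isCoupling (π := 0) ?_).trans (by simp)
    constructor <;> simp
  · unfold W1
    rw [ENNReal.mul_iInf_of_ne h0 hc]
    refine le_iInf fun π => ?_
    rw [ENNReal.mul_iInf_of_ne h0 hc]
    refine le_iInf fun hπ => (iInf₂_le (c • π) (IsCoupling.smul hπ c)).trans ?_
    rw [lintegral_smul_measure, smul_eq_mul]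

end Transport

section CompactTransport

lemma Ultrafilter.exists_tendsto {ι Y : Type*} [TopologicalSpace Y] [CompactSpace Y]
    (l : Ultrafilter ι) (f : ι → Y) : ∃ y, Tendsto f l (𝓝 y) := by
  obtain ⟨y, -, hy⟩ := isCompact_univ.ultrafilter_le_nhds (l.map f) (by simp)
  exact ⟨y, hy⟩

variable {X : Type*} [MeasurableSpace X] [MetricSpace X] [CompactSpace X] [BorelSpace X]

/-- Along an ultrafilter, couplings of converging marginals accumulate at a coupling of the limits,
and the transport cost passes to the limit. -/
lemma exists_isCoupling_of_tendsto {ι : Type*} {l : Ultrafilter ι}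
    {a b : ι → ProbabilityMeasure X} {A B : ProbabilityMeasure X}
    {π : ι → Measure (X × X)} {L : ℝ≥0∞}
    (hπ : ∀ i, IsCoupling (a i : Measure X) (b i) (π i))
    (ha : Tendsto a l (𝓝 A)) (hb : Tendsto b l (𝓝 B))
    (hL : Tendsto (fun i => ∫⁻ q, edist q.1 q.2 ∂(π i)) l (𝓝 L)) :
    ∃ p : Measure (X × X), IsCoupling (A : Measure X) B p ∧ ∫⁻ q, edist q.1 q.2 ∂p = L := by
  have hprob : ∀ i, IsProbabilityMeasure (π i) := fun i =>
    ⟨by rw [(hπ i).measure_univ_left, measure_univ]⟩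
  let P : ι → ProbabilityMeasure (X × X) := fun i => ⟨π i, hprob i⟩
  obtain ⟨p, hp⟩ := l.exists_tendsto P
  refine ⟨p, ⟨?_, ?_⟩, ?_⟩
  · have h1 := ProbabilityMeasure.tendsto_map_of_tendsto_of_continuous P p hp continuous_fst
    have h2 : (fun i => (P i).map (f := Prod.fst) continuous_fst.measurable.aemeasurable) = a := by
      funext i
      exact Subtype.ext (hπ i).1
    rw [h2] at h1
    exact congrArg ProbabilityMeasure.toMeasure (tendsto_nhds_unique h1 ha)
  · have h1 := ProbabilityMeasure.tendsto_map_of_tendsto_of_continuous P p hp continuous_snd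
    have h2 : (fun i => (P i).map (f := Prod.snd) continuous_snd.measurable.aemeasurable) = b := by
      funext i
      exact Subtype.ext (hπ i).2
    rw [h2] at h1
    exact congrArg ProbabilityMeasure.toMeasure (tendsto_nhds_unique h1 hb)
  · have h1 := ProbabilityMeasure.tendsto_iff_forall_lintegral_tendsto.1 hp
      (BoundedContinuousFunction.mkOfCompact ⟨fun q : X × X => nndist q.1 q.2, by fun_prop⟩)
    simp only [BoundedContinuousFunction.mkOfCompact_apply, ContinuousMap.coe_mk,
      ← edist_nndist] at h1
    exact tendsto_nhds_unique h1 hL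

lemma exists_isCoupling_lintegral_eq_W1 (a b : ProbabilityMeasure X) :
    ∃ p : Measure (X × X), IsCoupling (a : Measure X) b p ∧
      ∫⁻ q, edist q.1 q.2 ∂p = W1 (a : Measure X) b := by
  have hne : {π : Measure (X × X) | IsCoupling (a : Measure X) b π}.Nonempty :=
    ⟨(a : Measure X).prod b, by constructor <;> simp⟩
  obtain ⟨u, -, hu, hmem⟩ := exists_seq_tendsto_sInf
    (hne.image fun π => ∫⁻ q, edist q.1 q.2 ∂π) (OrderBot.bddBelow _)
  choose π hπ hcost using hmem
  refine exists_isCoupling_of_tendsto (l := hyperfilter ℕ) (a := fun _ => a) (b := fun _ => b)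
    hπ tendsto_const_nhds tendsto_const_nhds ?_
  rw [sInf_image] at hu
  simp only [hcost]
  exact hu.mono_left Nat.hyperfilter_le_atTop

/-- Lower semicontinuity of the Wasserstein distance along an ultrafilter. -/
lemma W1_le_of_tendsto {ι : Type*} {l : Ultrafilter ι}
    {a b : ι → ProbabilityMeasure X} {A B : ProbabilityMeasure X} {L : ℝ≥0∞}
    (ha : Tendsto a l (𝓝 A)) (hb : Tendsto b l (𝓝 B))
    (hL : Tendsto (fun i => W1 (a i : Measure X) (b i)) l (𝓝 L)) :
    W1 (A : Measure X) B ≤ L := by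
  choose π hπ hcost using fun i => exists_isCoupling_lintegral_eq_W1 (a i) (b i)
  obtain ⟨p, hp, rfl⟩ := exists_isCoupling_of_tendsto hπ ha hb (by simpa only [hcost] using hL)
  exact W1_le_of_isCoupling hp

lemma eq_of_W1_eq_zero {a b : ProbabilityMeasure X} (h : W1 (a : Measure X) b = 0) : a = b := by
  obtain ⟨p, hp, hcost⟩ := exists_isCoupling_lintegral_eq_W1 a b
  rw [h, lintegral_eq_zero_iff (by fun_prop)] at hcost
  refine Subtype.ext ?_
  change (a : Measure X) = b
  rw [← hp.1, ← hp.2]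
  exact Measure.map_congr (hcost.mono fun q hq => edist_eq_zero.1 hq)

end CompactTransport

section Variation

variable {X : Type*} {d : X → X → ℝ≥0∞} {f : ℝ → X} {s : Set ℝ}

lemma sum_le_varOn {u : ℕ → ℝ} (hu : Monotone u) (hus : ∀ i, u i ∈ s) (n : ℕ) :
    ∑ i ∈ Finset.range n, d (f (u (i + 1))) (f (u i)) ≤ varOn d f s :=
  le_iSup (fun p : ℕ × { u : ℕ → ℝ // Monotone u ∧ ∀ i, u i ∈ s } =>
    ∑ i ∈ Finset.range p.1, d (f (p.2.1 (i + 1))) (f (p.2.1 i))) (n, ⟨u, hu, hus⟩)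

lemma varOn_mono {r : Set ℝ} (h : r ⊆ s) : varOn d f r ≤ varOn d f s :=
  iSup_le fun p => sum_le_varOn p.2.2.1 (fun i => h (p.2.2.2 i)) p.1

/-- The variation up to `x` increases at least by `d (f y) (f x)` when passing from `x` to `y`. -/
lemma varOn_inter_Iic_add_le {x y : ℝ} (hx : x ∈ s) (hy : y ∈ s) (hxy : x ≤ y) :
    varOn d f (s ∩ Iic x) + d (f y) (f x) ≤ varOn d f (s ∩ Iic y) := by
  have : Nonempty (ℕ × { u : ℕ → ℝ // Monotone u ∧ ∀ i, u i ∈ s ∩ Iic x }) :=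
    ⟨(0, ⟨fun _ => x, monotone_const, fun _ => ⟨hx, self_mem_Iic⟩⟩)⟩
  rw [varOn, ENNReal.iSup_add]
  refine iSup_le ?_
  rintro ⟨n, u, hu, hus⟩
  let w : ℕ → ℝ := fun i => if i ≤ n then u i else if i = n + 1 then x else y
  have hw : Monotone w := by
    refine monotone_nat_of_le_succ fun i => ?_
    have h1 := (hus i).2
    have h2 := hu (Nat.le_succ i)
    simp only [w, mem_Iic] at *
    split_ifs <;> first | omega | linarith
  have hws : ∀ i, w i ∈ s ∩ Iic y := by
    intro i
    simp only [w]
    split_ifs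
    exacts [⟨(hus i).1, (hus i).2.trans hxy⟩, ⟨hx, hxy⟩, ⟨hy, self_mem_Iic⟩]
  have hsum : ∑ i ∈ Finset.range n, d (f (u (i + 1))) (f (u i)) =
      ∑ i ∈ Finset.range n, d (f (w (i + 1))) (f (w i)) := by
    refine Finset.sum_congr rfl fun i hi => ?_
    have hi' := Finset.mem_range.1 hi
    simp only [w, if_pos hi'.le, if_pos (show i + 1 ≤ n from hi')]
  have hlast : d (f y) (f x) = d (f (w (n + 1 + 1))) (f (w (n + 1))) := by
    simp [w]
  refine le_trans ?_ (sum_le_varOn hw hws (n + 2))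
  rw [Finset.sum_range_succ, Finset.sum_range_succ]
  simp only [hsum, hlast]
  gcongr
  exact le_self_add

lemma varOn_le_mul {Y : Type*} {e : Y → Y → ℝ≥0∞} {g : ℝ → Y} {c : ℝ≥0∞}
    (h : ∀ x ∈ s, ∀ y ∈ s, e (g x) (g y) ≤ c * d (f x) (f y)) :
    varOn e g s ≤ c * varOn d f s := by
  refine iSup_le fun p => ?_
  refine le_trans ?_ (mul_le_mul_right (sum_le_varOn (d := d) p.2.2.1 p.2.2.2 p.1) c)
  rw [Finset.mul_sum]
  exact Finset.sum_le_sum fun i _ => h _ (p.2.2.2 _) _ (p.2.2.2 _)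

lemma le_varOn {x y : ℝ} (hx : x ∈ s) (hy : y ∈ s) (hxy : x ≤ y) :
    d (f y) (f x) ≤ varOn d f s :=
  le_add_self.trans ((varOn_inter_Iic_add_le hx hy hxy).trans (varOn_mono inter_subset_left))

lemma essVar_le_varOn {g : ℝ → X} (h : ∀ᵐ t ∂lebI, g t = f t) :
    essVar d f ≤ varOn d g unitI :=
  iInf₂_le (f := fun g (_ : g ∈ {g : ℝ → X | ∀ᵐ t ∂lebI, g t = f t}) => varOn d g unitI) g h

lemma exists_varOn_lt_of_essVar_lt {r : ℝ≥0∞} (h : essVar d f < r) :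
    ∃ g : ℝ → X, (∀ᵐ t ∂lebI, g t = f t) ∧ varOn d g unitI < r := by
  simpa [essVar, essVarOn, iInf_lt_iff, lebI] using h

end Variation

section Helly

variable {X : Type*} [MeasurableSpace X] [MetricSpace X] [CompactSpace X] [BorelSpace X]

/-- Helly's selection theorem for curves of probability measures of bounded variation. -/
lemma exists_subseq_tendsto_of_varOn_le {h : ℕ → ℝ → ProbabilityMeasure X} {b : ℕ → ℝ≥0∞}
    {B : ℝ≥0∞} (hB : B ≠ ⊤) (hb : Tendsto b atTop (𝓝 B))
    (hvar : ∀ᶠ j in atTop, varOn W1P (h j) unitI ≤ b j) :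
    ∃ φ : ℕ → ℕ, StrictMono φ ∧ ∃ g : ℝ → ProbabilityMeasure X,
      (∀ t ∈ unitI, Tendsto (fun k => h (φ k) t) atTop (𝓝 (g t))) ∧
      varOn W1P g unitI ≤ B := by
  let l : Ultrafilter ℕ := hyperfilter ℕ
  have hl : (l : Filter ℕ) ≤ atTop := Nat.hyperfilter_le_atTop
  choose g hg using fun t => l.exists_tendsto fun j => h j t
  let v : ℕ → ℝ → ℝ≥0∞ := fun j t => varOn W1P (h j) (unitI ∩ Iic t)
  choose V hV using fun t => l.exists_tendsto fun j => v j t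
  have hVmono : Monotone V := fun s t hst => le_of_tendsto_of_tendsto' (hV s) (hV t) fun j =>
    varOn_mono (inter_subset_inter_right _ (Iic_subset_Iic.2 hst))
  have hVtop : ∀ t, V t ≠ ⊤ := fun t =>
    ((le_of_tendsto_of_tendsto (hV t) (hb.mono_left hl) ((hvar.filter_mono hl).mono fun j hj =>
      (varOn_mono inter_subset_left).trans hj)).trans_lt hB.lt_top).ne
  -- increments of the limit variation control the distance between limit points
  have key : ∀ (F : Ultrafilter ℕ) (ψ : ℕ → ℕ) (r t s : ℝ) (ν ν' : ProbabilityMeasure X),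
      t ∈ unitI → s ∈ unitI → r ≤ t → t ≤ s →
      Tendsto (fun k => h (ψ k) t) F (𝓝 ν) → Tendsto (fun k => h (ψ k) s) F (𝓝 ν') →
      Tendsto (fun k => v (ψ k) r) F (𝓝 (V r)) → Tendsto (fun k => v (ψ k) s) F (𝓝 (V s)) →
      W1 (ν' : Measure X) ν ≤ V s - V r := by
    intro F ψ r t s ν ν' ht hs hrt hts hν hν' hr hs'
    obtain ⟨w, hw⟩ := F.exists_tendsto fun k =>
      W1 (h (ψ k) s : Measure X) (h (ψ k) t)
    refine (W1_le_of_tendsto hν' hν hw).trans (ENNReal.le_sub_of_add_le_left (hVtop r) ?_)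
    refine le_of_tendsto_of_tendsto' (hr.add hw) hs' fun k => ?_
    refine le_trans ?_ (varOn_inter_Iic_add_le (d := W1P) (f := h (ψ k)) ht hs hts)
    exact add_le_add (varOn_mono (inter_subset_inter_right _ (Iic_subset_Iic.2 hrt))) le_rfl
  -- a countable set of times containing all rational times and all jumps of the limit variation
  let D : Set ℝ := range ((↑) : ℚ → ℝ) ∪ {t | ¬ ContinuousAt V t}
  have hD : D.Countable := (countable_range _).union hVmono.countable_not_continuousAt
  have : Countable D := hD.to_subtype
  let G : ℕ → D → ProbabilityMeasure X × ℝ≥0∞ := fun j t => (h j t, v j t)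
  have hG : Tendsto G l (𝓝 fun t : D => (g t, V t)) :=
    tendsto_pi_nhds.2 fun t => (hg t).prodMk_nhds (hV t)
  obtain ⟨φ, hφ, hφG⟩ := (hG.mapClusterPt.mono hl).tendsto_subseq
  have hφh : ∀ t ∈ D, Tendsto (fun k => h (φ k) t) atTop (𝓝 (g t)) := fun t ht =>
    (continuous_fst.tendsto _).comp (tendsto_pi_nhds.1 hφG ⟨t, ht⟩)
  have hφv : ∀ t ∈ D, Tendsto (fun k => v (φ k) t) atTop (𝓝 (V t)) := fun t ht =>
    (continuous_snd.tendsto _).comp (tendsto_pi_nhds.1 hφG ⟨t, ht⟩)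
  refine ⟨φ, hφ, g, fun t ht => ?_, ?_⟩
  · by_cases htD : t ∈ D
    · exact hφh t htD
    have htc : ContinuousAt V t := by
      by_contra hc
      exact htD (Or.inr hc)
    have hrat : ∀ q : ℚ, (q : ℝ) ∈ D := fun q => Or.inl ⟨q, rfl⟩
    have ht1 : t < 1 := lt_of_le_of_ne ht.2 fun h1 => htD (by simpa [h1] using hrat 1)
    obtain ⟨p, -, hpt, hp⟩ := Real.exists_seq_rat_strictMono_tendsto t
    obtain ⟨q, -, hqt, hq⟩ := Real.exists_seq_rat_strictAnti_tendsto t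
    have hqI : ∀ᶠ k in atTop, (q k : ℝ) ∈ unitI := by
      filter_upwards [hq.eventually (gt_mem_nhds ht1)] with k hk
      exact ⟨ht.1.trans (hqt k).le, hk.le⟩
    obtain ⟨κ, hκ⟩ := l.exists_tendsto fun k => g (q k)
    have hgap : Tendsto (fun k => V (q k) - V (p k)) l (𝓝 0) := by
      have := ENNReal.Tendsto.sub (htc.tendsto.comp hq) (htc.tendsto.comp hp) (Or.inl (hVtop t))
      rw [tsub_self] at this
      exact this.mono_left hl
    have huniq : ∀ ν : ProbabilityMeasure X,
        (∀ k, (q k : ℝ) ∈ unitI → W1 (g (q k) : Measure X) ν ≤ V (q k) - V (p k)) → κ = ν := by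
      intro ν hν
      refine eq_of_W1_eq_zero (le_antisymm ?_ zero_le)
      refine W1_le_of_tendsto hκ tendsto_const_nhds ?_
      exact tendsto_of_tendsto_of_tendsto_of_le_of_le' tendsto_const_nhds hgap
        (Eventually.of_forall fun _ => zero_le) ((hqI.filter_mono hl).mono hν)
    have hκt : κ = g t := huniq _ fun k hk =>
      key l id (p k) t (q k) _ _ ht hk (hpt k).le (hqt k).le (hg t) (hg _) (hV _) (hV _)
    refine tendsto_iff_ultrafilter _ _ _ |>.2 fun F hF => ?_
    obtain ⟨ν, hν⟩ := F.exists_tendsto fun k => h (φ k) t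
    have hκν : κ = ν := huniq ν fun k hk =>
      key F φ (p k) t (q k) _ _ ht hk (hpt k).le (hqt k).le hν ((hφh _ (hrat _)).mono_left hF)
        ((hφv _ (hrat _)).mono_left hF) ((hφv _ (hrat _)).mono_left hF)
    rwa [← hκt, hκν]
  · refine iSup_le ?_
    rintro ⟨n, u, hu, hus⟩
    choose w hw using fun i => l.exists_tendsto fun j =>
      W1 (h j (u (i + 1)) : Measure X) (h j (u i))
    refine (Finset.sum_le_sum fun i _ => W1_le_of_tendsto (hg _) (hg _) (hw i)).trans ?_
    refine le_of_tendsto_of_tendsto (tendsto_finsetSum _ fun i _ => hw i) (hb.mono_left hl) ?_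
    filter_upwards [hvar.filter_mono hl] with j hj
    exact (sum_le_varOn (d := W1P) hu hus n).trans hj

end Helly

section EssVar

variable {X : Type*} [MeasurableSpace X] [PseudoEMetricSpace X]

lemma essVar_W1M_smul_le (c : ℝ≥0) (ρ : ℝ → ProbabilityMeasure X) :
    essVar W1M (fun t => (c : ℝ≥0∞) • (ρ t : Measure X)) ≤ c * varOn W1P ρ unitI :=
  (essVar_le_varOn (ae_of_all _ fun _ => rfl)).trans
    (varOn_le_mul fun _ _ _ _ => W1_smul_le _ _ ENNReal.coe_ne_top)

lemma essVar_W1M_smul_lt_top (c : ℝ≥0) {ρ : ℝ → ProbabilityMeasure X}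
    (hρ : essVar W1P ρ < ⊤) : essVar W1M (fun t => (c : ℝ≥0∞) • (ρ t : Measure X)) < ⊤ := by
  obtain ⟨σ, hσ, hlt⟩ := exists_varOn_lt_of_essVar_lt hρ
  refine lt_of_le_of_lt (essVar_le_varOn (g := fun t => (c : ℝ≥0∞) • (σ t : Measure X)) ?_)
    ((varOn_le_mul (d := W1P) (f := σ) (c := c) fun _ _ _ _ =>
      W1_smul_le _ _ ENNReal.coe_ne_top).trans_lt (ENNReal.mul_lt_top ENNReal.coe_lt_top hlt))
  exact hσ.mono fun t ht => by simp only [ht]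

/-- A weighted curve of probability measures has almost optimal representatives which are again
weighted curves of probability measures. -/
lemma exists_ae_eq_varOn_le {c : ℝ≥0} (hc : 0 < c) {ρ : ℝ → ProbabilityMeasure X} {r : ℝ≥0∞}
    (hr : r ≠ ⊤) (hlt : essVar W1M (fun t => (c : ℝ≥0∞) • (ρ t : Measure X)) < r) :
    ∃ σ : ℝ → ProbabilityMeasure X, (∀ᵐ t ∂lebI, σ t = ρ t) ∧
      varOn W1P σ unitI ≤ (c : ℝ≥0∞)⁻¹ * r := by
  obtain ⟨γ, hγ, hγr⟩ := exists_varOn_lt_of_essVar_lt hlt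
  have hc0 : (c : ℝ≥0∞) ≠ 0 := by exact_mod_cast hc.ne'
  have hinv : (c : ℝ≥0∞)⁻¹ * c = 1 := ENNReal.inv_mul_cancel hc0 ENNReal.coe_ne_top
  obtain ⟨t₀, ht₀, ht₀I⟩ : ∃ t₀, γ t₀ = (c : ℝ≥0∞) • (ρ t₀ : Measure X) ∧ t₀ ∈ unitI := by
    have : NeZero lebI := ⟨by simp [lebI, unitI]⟩
    exact (hγ.and (ae_restrict_mem measurableSet_Icc)).exists
  have hfin : varOn W1M γ unitI ≠ ⊤ := (hγr.trans hr.lt_top).ne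
  have hmass : ∀ t ∈ unitI, γ t univ = c := by
    intro t ht
    have h₀ : γ t₀ univ = c := by simp [ht₀]
    rcases le_total t₀ t with h | h
    · rw [← h₀]
      exact measure_univ_eq_of_W1_ne_top (ne_top_of_le_ne_top hfin (le_varOn ht₀I ht h))
    · rw [← h₀]
      exact (measure_univ_eq_of_W1_ne_top (ne_top_of_le_ne_top hfin (le_varOn ht ht₀I h))).symm
  classical
  let σ : ℝ → ProbabilityMeasure X := fun t =>
    if ht : t ∈ unitI then ⟨(c : ℝ≥0∞)⁻¹ • γ t, ⟨by simp [hmass t ht, hinv]⟩⟩ else ρ t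
  have hσ : ∀ t ∈ unitI, (σ t : Measure X) = (c : ℝ≥0∞)⁻¹ • γ t := by
    intro t ht
    simp [σ, ht]
  refine ⟨σ, ?_, ?_⟩
  · filter_upwards [hγ, ae_restrict_mem measurableSet_Icc] with t ht htI
    refine Subtype.ext ((hσ t htI).trans ?_)
    rw [ht, smul_smul, hinv, one_smul]
    rfl
  · refine (varOn_le_mul (d := W1M) (f := γ) (c := (c : ℝ≥0∞)⁻¹) fun x hx y hy => ?_).trans
      (mul_le_mul_right hγr.le _)
    simp only [W1P, hσ x hx, hσ y hy]
    exact W1_smul_le _ _ (ENNReal.inv_ne_top.2 hc0)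

end EssVar

lemma wStarTendsto_smul_of_tendsto {X : Type*} [MeasurableSpace X] [TopologicalSpace X]
    [CompactSpace X] [OpensMeasurableSpace X] {c : ℕ → ℝ≥0} {C : ℝ≥0}
    {ρ : ℕ → ProbabilityMeasure X} {σ : ProbabilityMeasure X}
    (hc : Tendsto c atTop (𝓝 C)) (hρ : Tendsto ρ atTop (𝓝 σ)) :
    WStarTendsto (fun k => (c k : ℝ≥0∞) • (ρ k : Measure X))
      ((C : ℝ≥0∞) • (σ : Measure X)) := by
  intro ψ
  have h := ProbabilityMeasure.tendsto_iff_forall_integral_tendsto.1 hρ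
    (BoundedContinuousFunction.mkOfCompact ψ)
  simp only [integral_smul_measure, ENNReal.coe_toReal, smul_eq_mul]
  exact (NNReal.tendsto_coe.2 hc).mul h

lemma wStarTendsto_smul_of_tendsto_zero {X : Type*} [MeasurableSpace X] [TopologicalSpace X]
    [CompactSpace X] {c : ℕ → ℝ≥0} (ρ : ℕ → ProbabilityMeasure X)
    (hc : Tendsto c atTop (𝓝 0)) :
    WStarTendsto (fun k => (c k : ℝ≥0∞) • (ρ k : Measure X)) 0 := by
  intro ψ
  simp only [integral_smul_measure, ENNReal.coe_toReal, smul_eq_mul, integral_zero_measure]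
  have hc' : Tendsto (fun k => (c k : ℝ)) atTop (𝓝 0) := by
    simpa using NNReal.tendsto_coe.2 hc
  refine hc'.zero_mul_isBoundedUnder_le (isBoundedUnder_of ⟨‖ψ‖, fun k => ?_⟩)
  simpa using norm_integral_le_of_norm_le_const (μ := (ρ k : Measure X))
    (ae_of_all _ fun x => ψ.norm_coe_le_norm x)

/-- Compactness in `(𝒜, 𝓡_{α,β})`: any sequence in `𝒜` along which the
regularizer is uniformly bounded has a subsequence converging a.e. weak-* to some `μ ∈ 𝒜`,
with `𝓡_{α,β}(μ) ≤ liminf_j 𝓡_{α,β}(μʲ)`. -/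
theorem compactness_in_Adm
    {n : ℕ} (Ω : Set (EuclideanSpace ℝ (Fin n)))
    (hΩne : Ω.Nonempty) (hΩcp : IsCompact Ω) (hΩcv : Convex ℝ Ω)
    (α β : ℝ) (hα : 0 < α) (hβ : 0 < β)
    (μs : ℕ → (ℝ → Measure ↥Ω)) (hμsAdm : ∀ j, μs j ∈ Adm Ω)
    (hbdd : ∃ C : ℝ, ∀ j, Reg α β (μs j) ≤ C) :
    ∃ φ : ℕ → ℕ, StrictMono φ ∧ ∃ μ ∈ Adm Ω,
      AEWStar (fun k => μs (φ k)) μ ∧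
      Reg α β μ ≤ Filter.liminf (fun j => Reg α β (μs j)) Filter.atTop := by
  have : CompactSpace Ω := isCompact_iff_compactSpace.1 hΩcp
  choose c ρ hρ hμ using hμsAdm
  replace hμ : ∀ j, μs j = fun t => (c j : ℝ≥0∞) • (ρ j t : Measure Ω) := fun j => funext (hμ j)
  obtain ⟨C, hC⟩ := hbdd
  have hwt : ∀ j, wt (μs j) = c j := fun j => by simp [wt, hμ]
  have hreg : ∀ j, Reg α β (μs j) = α * c j + β * (essVar W1M (μs j)).toReal := fun j => by
    rw [Reg, hwt]
  have hαc : ∀ j, α * c j ≤ Reg α β (μs j) := fun j => by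
    rw [hreg]
    exact le_add_of_nonneg_right (by positivity)
  have hreg0 : ∀ j, 0 ≤ Reg α β (μs j) := fun j => le_trans (by positivity) (hαc j)
  set L := liminf (fun j => Reg α β (μs j)) atTop
  have hcobdd : IsCoboundedUnder (· ≥ ·) atTop fun j => Reg α β (μs j) :=
    (isBoundedUnder_of ⟨C, hC⟩ : IsBoundedUnder (· ≤ ·) atTop _).isCoboundedUnder_ge
  have hL0 : 0 ≤ L := le_liminf_of_le hcobdd (Eventually.of_forall hreg0)
  let e : ℕ → ℝ := fun k => 1 / ((k : ℝ) + 1)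
  have he0 : ∀ k, 0 < e k := fun k => by positivity
  have he : Tendsto e atTop (𝓝 0) := tendsto_one_div_add_atTop_nhds_zero_nat
  obtain ⟨φ₁, hφ₁, hφ₁L⟩ : ∃ φ : ℕ → ℕ, StrictMono φ ∧ ∀ k, Reg α β (μs (φ k)) < L + e k :=
    extraction_forall_of_frequently fun k =>
      frequently_lt_of_liminf_lt hcobdd (lt_add_of_pos_right L (he0 k))
  obtain ⟨c', -, φ₂, hφ₂, hc'⟩ : ∃ c' ∈ Icc 0 (C / α).toNNReal, ∃ φ : ℕ → ℕ, StrictMono φ ∧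
      Tendsto ((fun k => c (φ₁ k)) ∘ φ) atTop (𝓝 c') := by
    refine isCompact_Icc.tendsto_subseq fun k => ⟨zero_le, ?_⟩
    refine NNReal.le_toNNReal_of_coe_le ((le_div_iff₀ hα).2 ?_)
    rw [mul_comm]
    exact (hαc _).trans (hC _)
  let φ₃ : ℕ → ℕ := φ₁ ∘ φ₂
  have hφ₃ : StrictMono φ₃ := hφ₁.comp hφ₂
  have hφ₃c : Tendsto (fun k => c (φ₃ k)) atTop (𝓝 c') := hc'
  have hφ₃c' : Tendsto (fun k => (c (φ₃ k) : ℝ)) atTop (𝓝 c') := NNReal.tendsto_coe.2 hc'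
  let e' : ℕ → ℝ := fun k => e (φ₂ k)
  have he' : Tendsto e' atTop (𝓝 0) := he.comp hφ₂.tendsto_atTop
  have hφ₃L : ∀ k, Reg α β (μs (φ₃ k)) < L + e' k := fun k => hφ₁L (φ₂ k)
  rcases eq_or_ne c' 0 with rfl | hc'0
  · obtain ⟨x, hx⟩ := hΩne
    let δ : ProbabilityMeasure Ω := ⟨Measure.dirac ⟨x, hx⟩, inferInstance⟩
    have hvar0 : essVar W1M (fun _ : ℝ => (0 : Measure Ω)) = 0 := by
      simpa using essVar_W1M_smul_le 0 fun _ => δ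
    refine ⟨φ₃, hφ₃, fun _ => 0, ⟨0, fun _ => δ, ?_, by simp⟩, ?_, ?_⟩
    · have hδ : W1P δ δ = 0 := le_antisymm ((W1_le_of_isCoupling
        (π := (δ : Measure Ω).map fun x => (x, x)) (by
          constructor <;> rw [Measure.map_map (by fun_prop) (by fun_prop)] <;>
          exact Measure.map_id)).trans (by
            rw [lintegral_map (by fun_prop) (by fun_prop)]
            simp)) zero_le
      refine lt_of_le_of_lt (essVar_le_varOn (ae_of_all _ fun _ => rfl)) ?_
      simp [varOn, hδ]
    · refine ae_of_all _ fun t => ?_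
      simpa only [hμ] using wStarTendsto_smul_of_tendsto_zero (fun k => ρ (φ₃ k) t) hφ₃c
    · simpa [Reg, wt, hvar0] using hL0
  · have hc'pos : 0 < c' := pos_iff_ne_zero.2 hc'0
    have hc'E : (c' : ℝ≥0∞) ≠ 0 := by exact_mod_cast hc'0
    have hσ : ∀ k, ∃ σ : ℝ → ProbabilityMeasure Ω, 0 < c (φ₃ k) →
        (∀ᵐ t ∂lebI, σ t = ρ (φ₃ k) t) ∧ varOn W1P σ unitI ≤
          (c (φ₃ k) : ℝ≥0∞)⁻¹ * ENNReal.ofReal ((L + e' k - α * c (φ₃ k)) / β) := by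
      intro k
      by_cases hk : 0 < c (φ₃ k)
      · have hfin : essVar W1M (μs (φ₃ k)) < ⊤ := by
          rw [hμ]
          exact essVar_W1M_smul_lt_top _ (hρ _)
        have hlt : essVar W1M (μs (φ₃ k)) <
            ENNReal.ofReal ((L + e' k - α * c (φ₃ k)) / β) := by
          rw [ENNReal.lt_ofReal_iff_toReal_lt hfin.ne, lt_div_iff₀ hβ]
          have := hφ₃L k
          rw [hreg] at this
          linarith
        rw [hμ] at hlt
        obtain ⟨σ, h⟩ := exists_ae_eq_varOn_le hk ENNReal.ofReal_ne_top hlt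
        exact ⟨σ, fun _ => h⟩
      · exact ⟨ρ (φ₃ k), fun h => absurd h hk⟩
    choose σ hσ using hσ
    have hpos : ∀ᶠ k in atTop, 0 < c (φ₃ k) := hφ₃c.eventually (lt_mem_nhds hc'pos)
    let B : ℝ≥0∞ := (c' : ℝ≥0∞)⁻¹ * ENNReal.ofReal ((L - α * c') / β)
    have hB : B ≠ ⊤ := ENNReal.mul_ne_top (ENNReal.inv_ne_top.2 hc'E) ENNReal.ofReal_ne_top
    have hb : Tendsto (fun k => (c (φ₃ k) : ℝ≥0∞)⁻¹ *
        ENNReal.ofReal ((L + e' k - α * c (φ₃ k)) / β)) atTop (𝓝 B) := by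
      refine ENNReal.Tendsto.mul (tendsto_inv_iff.2 (ENNReal.tendsto_coe.2 hφ₃c))
        (Or.inr ENNReal.ofReal_ne_top) (ENNReal.tendsto_ofReal ?_)
        (Or.inr (ENNReal.inv_ne_top.2 hc'E))
      simpa using ((he'.const_add L).sub (hφ₃c'.const_mul α)).div_const β
    obtain ⟨φ₄, hφ₄, g, hg, hgB⟩ := exists_subseq_tendsto_of_varOn_le hB hb
      (hpos.mono fun k hk => (hσ k hk).2)
    refine ⟨φ₃ ∘ φ₄, hφ₃.comp hφ₄, fun t => (c' : ℝ≥0∞) • (g t : Measure Ω),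
      ⟨c', g, ?_, fun _ => rfl⟩, ?_, ?_⟩
    · exact (essVar_le_varOn (ae_of_all _ fun _ => rfl)).trans_lt (hgB.trans_lt hB.lt_top)
    · have hae : ∀ᵐ t ∂lebI, ∀ k, 0 < c (φ₃ k) → σ k t = ρ (φ₃ k) t := by
        refine ae_all_iff.2 fun k => ?_
        by_cases hk : 0 < c (φ₃ k)
        · exact (hσ k hk).1.mono fun t ht _ => ht
        · exact ae_of_all _ fun t h => absurd h hk
      filter_upwards [hae, ae_restrict_mem measurableSet_Icc] with t ht htI
      simp only [Function.comp_apply, hμ]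
      refine wStarTendsto_smul_of_tendsto (hφ₃c.comp hφ₄.tendsto_atTop) ?_
      refine (hg t htI).congr' ?_
      filter_upwards [hφ₄.tendsto_atTop.eventually hpos] with k hk
      exact ht _ hk
    · have hnonneg : 0 ≤ (L - α * c') / β := by
        refine div_nonneg (sub_nonneg.2 ?_) hβ.le
        refine le_of_tendsto_of_tendsto' (hφ₃c'.const_mul α) (by simpa using he'.const_add L)
          fun k => (hαc _).trans (hφ₃L k).le
      have hess : (essVar W1M fun t => (c' : ℝ≥0∞) • (g t : Measure Ω)).toReal ≤
          (L - α * c') / β := by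
        refine ENNReal.toReal_le_of_le_ofReal hnonneg ((essVar_W1M_smul_le c' g).trans ?_)
        refine (mul_le_mul_right hgB _).trans_eq ?_
        rw [← mul_assoc, ENNReal.mul_inv_cancel hc'E ENNReal.coe_ne_top, one_mul]
      have hwt' : wt (fun t => (c' : ℝ≥0∞) • (g t : Measure Ω)) = c' := by simp [wt]
      rw [Reg, hwt']
      rw [le_div_iff₀ hβ] at hess
      linarith

end
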